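/- Let d ≥ 1, let Δ be a G_δ-subset of the projective space P(ℝ^d), and let D be a countable subset of Δ. Then there exists a free measure preserving ℤ^d-action T on a σ-finite standard measure space (X, μ) with μ(X) = ∞ such that D ⊆ 𝓡i(T) ⊆ Δ, where 𝓡i(T) is the set of rigid directions of T. -/

import Mathlib

open MeasureTheory Filter Set Topology

noncomputable section

instance {d : ℕ} : TopologicalSpace (Projectivization ℝ (Fin d → ℝ)) :=
  inferInstanceAs (TopologicalSpace (Quotient _))

/-- The coordinatewise cast of an integer vector to a real vector. -/
def zcast {d : ℕ} (γ : Fin d → ℤ) : Fin d → ℝ := fun i => (γ i : ℝ)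

/-- `T` is a measure preserving `ℤ^d`-action on `(X, μ)`. -/
def IsMPAction {d : ℕ} {X : Type*} [MeasurableSpace X] (μ : Measure X)
    (T : (Fin d → ℤ) → X ≃ᵐ X) : Prop :=
  (∀ γ γ' : Fin d → ℤ, ∀ x : X, T (γ + γ') x = T γ (T γ' x)) ∧
    ∀ γ : Fin d → ℤ, MeasurePreserving (T γ) μ μ

/-- The action `T` is free. -/
def IsFreeAction {d : ℕ} {X : Type*} [MeasurableSpace X] (μ : Measure X)
    (T : (Fin d → ℤ) → X ≃ᵐ X) : Prop :=
  ∀ γ : Fin d → ℤ, γ ≠ 0 → ∀ᵐ x ∂μ, T γ x ≠ x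

/-- `T` is recurrent along the line `θ ∈ P(ℝ^d)`. -/
def RecurrentAlong {d : ℕ} {X : Type*} [MeasurableSpace X] (μ : Measure X)
    (T : (Fin d → ℤ) → X ≃ᵐ X) (θ : Projectivization ℝ (Fin d → ℝ)) : Prop :=
  ∀ ε : ℝ, 0 < ε → ∀ A : Set X, MeasurableSet A → 0 < μ A →
    ∃ γ : Fin d → ℤ, γ ≠ 0 ∧ ∃ v ∈ θ.submodule, ‖zcast γ - v‖ < ε ∧ 0 < μ (A ∩ T γ '' A)

/-- The set of recurrent directions `𝓡(T)`. -/
def recSet {d : ℕ} {X : Type*} [MeasurableSpace X] (μ : Measure X)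
    (T : (Fin d → ℤ) → X ≃ᵐ X) : Set (Projectivization ℝ (Fin d → ℝ)) :=
  {θ | RecurrentAlong μ T θ}

/-- `T` is rigid along the line `θ ∈ P(ℝ^d)`. -/
def RigidAlong {d : ℕ} {X : Type*} [MeasurableSpace X] (μ : Measure X)
    (T : (Fin d → ℤ) → X ≃ᵐ X) (θ : Projectivization ℝ (Fin d → ℝ)) : Prop :=
  ∃ γ : ℕ → Fin d → ℤ,
    Tendsto (fun n => ‖zcast (γ n)‖) atTop atTop ∧
    Tendsto (fun n => Metric.infDist (zcast (γ n)) ((θ.submodule : Set (Fin d → ℝ)))) atTop (𝓝 0) ∧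
    ∀ A : Set X, MeasurableSet A → μ A < ⊤ →
      Tendsto (fun n => μ (A ∩ T (γ n) '' A)) atTop (𝓝 (μ A))

/-- The set of rigid directions `𝓡i(T)`. -/
def rigSet {d : ℕ} {X : Type*} [MeasurableSpace X] (μ : Measure X)
    (T : (Fin d → ℤ) → X ≃ᵐ X) : Set (Projectivization ℝ (Fin d → ℝ)) :=
  {θ | RigidAlong μ T θ}

/-- The measure `Leb × μ` on `[0,1)^d × X`. -/
def indMeasure {d : ℕ} {X : Type*} [MeasurableSpace X] (μ : Measure X) :
    Measure ((Fin d → ℝ) × X) :=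
  (Measure.pi fun _ : Fin d => (volume : Measure ℝ).restrict (Set.Ico 0 1)).prod μ

/-- The induced `ℝ^d`-action `T̃_t(y, x) = ({t+y}, T_{[t+y]} x)`. -/
def indMap {d : ℕ} {X : Type*} [MeasurableSpace X] (T : (Fin d → ℤ) → X ≃ᵐ X)
    (t : Fin d → ℝ) : (Fin d → ℝ) × X → (Fin d → ℝ) × X :=
  fun p => (fun i => Int.fract (t i + p.1 i), T (fun i => ⌊t i + p.1 i⌋) p.2)

/-- A one-parameter flow `F` on `(Y, ν)` is conservative. -/
def FlowConservative {Y : Type*} [MeasurableSpace Y] (ν : Measure Y) (F : ℝ → Y → Y) : Prop :=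
  ∀ B : Set Y, MeasurableSet B → 0 < ν B → ∀ K : Set ℝ, IsCompact K →
    ∃ s : ℝ, s ∉ K ∧ 0 < ν (B ∩ F s '' B)

/-- A one-parameter flow `F` on `(Y, ν)` is rigid. -/
def FlowRigid {Y : Type*} [MeasurableSpace Y] (ν : Measure Y) (F : ℝ → Y → Y) : Prop :=
  ∃ s : ℕ → ℝ, Tendsto s atTop atTop ∧
    ∀ B : Set Y, MeasurableSet B → ν B < ⊤ →
      Tendsto (fun n => ν (B ∩ F (s n) '' B)) atTop (𝓝 (ν B))

/-- An `ℝ^d`-action `R` on `(Y, ν)` is recurrent along the line `θ`: the flow along some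
(equivalently, every) nonzero vector of `θ` is conservative. -/
def ActionRecurrentAlong {d : ℕ} {Y : Type*} [MeasurableSpace Y] (ν : Measure Y)
    (R : (Fin d → ℝ) → Y → Y) (θ : Projectivization ℝ (Fin d → ℝ)) : Prop :=
  ∃ v ∈ θ.submodule, v ≠ (0 : Fin d → ℝ) ∧ FlowConservative ν (fun s => R (s • v))

/-- An `ℝ^d`-action `R` on `(Y, ν)` is rigid along the line `θ`. -/
def ActionRigidAlong {d : ℕ} {Y : Type*} [MeasurableSpace Y] (ν : Measure Y)
    (R : (Fin d → ℝ) → Y → Y) (θ : Projectivization ℝ (Fin d → ℝ)) : Prop :=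
  ∃ v ∈ θ.submodule, v ≠ (0 : Fin d → ℝ) ∧ FlowRigid ν (fun s => R (s • v))

open scoped symmDiff

/-- The action of `ℤ^d` on `𝕋^d × ℂ` rotating the fibre over `y` by the character `y`. -/
def fiberRotation {d : ℕ} (γ : Fin d → ℤ) :
    UnitAddTorus (Fin d) × ℂ ≃ᵐ UnitAddTorus (Fin d) × ℂ where
  toFun p := (p.1, UnitAddTorus.mFourier γ p.1 * p.2)
  invFun p := (p.1, UnitAddTorus.mFourier (-γ) p.1 * p.2)
  left_inv p := by
    simp [← mul_assoc, ← UnitAddTorus.mFourier_add, UnitAddTorus.mFourier_zero]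
  right_inv p := by
    simp [← mul_assoc, ← UnitAddTorus.mFourier_add, UnitAddTorus.mFourier_zero]
  measurable_toFun := by
    refine Continuous.measurable ?_
    simp only [Equiv.coe_fn_mk]
    fun_prop
  measurable_invFun := by
    refine Continuous.measurable ?_
    simp only [Equiv.coe_fn_symm_mk]
    fun_prop

theorem fiberRotation_apply {d : ℕ} (γ : Fin d → ℤ) (p : UnitAddTorus (Fin d) × ℂ) :
    fiberRotation γ p = (p.1, UnitAddTorus.mFourier γ p.1 * p.2) := rfl

theorem fiberRotation_symm_apply {d : ℕ} (γ : Fin d → ℤ) (p : UnitAddTorus (Fin d) × ℂ) :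
    (fiberRotation γ).symm p = (p.1, UnitAddTorus.mFourier (-γ) p.1 * p.2) := rfl

theorem norm_mFourier_apply {d : ℕ} (γ : Fin d → ℤ) (y : UnitAddTorus (Fin d)) :
    ‖UnitAddTorus.mFourier γ y‖ = 1 := by
  simp [UnitAddTorus.mFourier, norm_prod, fourier_apply, Circle.norm_coe]

theorem integrable_mFourier {d : ℕ} (ν : Measure (UnitAddTorus (Fin d))) [IsFiniteMeasure ν]
    (γ : Fin d → ℤ) : Integrable (UnitAddTorus.mFourier γ) ν :=
  .of_bound (UnitAddTorus.mFourier γ).continuous.aestronglyMeasurable 1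
    (ae_of_all _ fun y => (norm_mFourier_apply γ y).le)

theorem measurePreserving_const_mul_complex {w : ℂ} (hw : ‖w‖ = 1) :
    MeasurePreserving (fun z : ℂ => w * z) volume volume := by
  let c : Circle := ⟨w, by simp [Submonoid.unitSphere, hw]⟩
  refine ⟨measurable_const_mul w, ?_⟩
  have := Measure.map_linearMap_addHaar_eq_smul_addHaar (volume : Measure ℂ)
    (f := ((rotation c).toLinearEquiv : ℂ →ₗ[ℝ] ℂ)) (by rw [det_rotation]; exact one_ne_zero)
  rw [det_rotation] at this
  have hfun : (fun z : ℂ => w * z) = rotation c := by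
    ext z
    rw [rotation_apply]
  rw [hfun]
  simpa using this

theorem isMPAction_fiberRotation {d : ℕ} (ν : Measure (UnitAddTorus (Fin d)))
    [IsProbabilityMeasure ν] :
    IsMPAction (ν.prod (volume : Measure ℂ)) fiberRotation := by
  refine ⟨fun γ γ' x => ?_, fun γ => ?_⟩
  · simp [fiberRotation_apply, UnitAddTorus.mFourier_add, mul_assoc]
  · refine (MeasurePreserving.id ν).skew_product
      (g := fun y z => UnitAddTorus.mFourier γ y * z) ?_ ?_
    · refine Continuous.measurable ?_
      simp only [Function.uncurry_def]
      fun_prop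
    · exact ae_of_all _ fun y =>
        (measurePreserving_const_mul_complex (norm_mFourier_apply γ y)).map_eq

theorem isFreeAction_fiberRotation {d : ℕ} (ν : Measure (UnitAddTorus (Fin d)))
    [IsProbabilityMeasure ν]
    (hν : ∀ γ : Fin d → ℤ, γ ≠ 0 → ν {y | UnitAddTorus.mFourier γ y = 1} = 0) :
    IsFreeAction (ν.prod (volume : Measure ℂ)) fiberRotation := by
  intro γ hγ
  have h1 : ∀ᵐ p ∂(ν.prod (volume : Measure ℂ)), UnitAddTorus.mFourier γ p.1 ≠ 1 :=
    Measure.quasiMeasurePreserving_fst.ae (p := fun y => UnitAddTorus.mFourier γ y ≠ 1)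
      (by simpa [ae_iff] using hν γ hγ)
  have h2 : ∀ᵐ p ∂(ν.prod (volume : Measure ℂ)), p.2 ≠ 0 :=
    Measure.quasiMeasurePreserving_snd.ae (p := fun z => z ≠ 0) (by simp [ae_iff])
  filter_upwards [h1, h2] with p hp1 hp2 h
  rw [fiberRotation_apply, Prod.ext_iff] at h
  exact hp1 ((mul_eq_right₀ hp2).1 h.2)

theorem tendsto_measure_inter_mul_preimage {w : ℕ → ℂ} (hw : ∀ n, ‖w n‖ = 1)
    (hw1 : Tendsto w atTop (𝓝 1)) {B : Set ℂ} (hB : MeasurableSet B) (hBfin : volume B ≠ ⊤) :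
    Tendsto (fun n => volume (B ∩ (fun z => w n * z) ⁻¹' B)) atTop (𝓝 (volume B)) := by
  let m : C(ℂ, C(ℂ, ℂ)) := ContinuousMap.curry ⟨fun p : ℂ × ℂ => p.1 * p.2, by fun_prop⟩
  have hm : Tendsto (fun n => m (w n)) atTop (𝓝 (m 1)) := (m.continuous.tendsto 1).comp hw1
  have key := tendsto_measure_symmDiff_preimage_nhds_zero hm
    (Eventually.of_forall fun n => measurePreserving_const_mul_complex (hw n))
    (measurePreserving_const_mul_complex (w := 1) (by simp)) hB.nullMeasurableSet hBfin
  have hsub : Tendsto (fun n => volume B - volume ((m (w n) ⁻¹' B) ∆ (m 1 ⁻¹' B))) atTop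
      (𝓝 (volume B)) := by
    simpa using ENNReal.Tendsto.sub tendsto_const_nhds key (Or.inl hBfin)
  refine tendsto_of_tendsto_of_tendsto_of_le_of_le hsub tendsto_const_nhds (fun n => ?_)
    (fun n => measure_mono inter_subset_left)
  refine tsub_le_iff_right.2 ((measure_mono ?_).trans (measure_union_le _ _))
  intro z hz
  by_cases h : w n * z ∈ B
  · exact Or.inl ⟨hz, h⟩
  · exact Or.inr (Or.inr ⟨by simpa [m] using hz, h⟩)

theorem tendsto_measure_inter_fiberRotation {d : ℕ} (ν : Measure (UnitAddTorus (Fin d)))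
    [IsProbabilityMeasure ν] {γ : ℕ → Fin d → ℤ}
    (hγ : ∀ᵐ y ∂ν, Tendsto (fun n => UnitAddTorus.mFourier (γ n) y) atTop (𝓝 1))
    {A : Set (UnitAddTorus (Fin d) × ℂ)} (hA : MeasurableSet A)
    (hAfin : ν.prod (volume : Measure ℂ) A < ⊤) :
    Tendsto (fun n => ν.prod (volume : Measure ℂ) (A ∩ fiberRotation (γ n) '' A)) atTop
      (𝓝 (ν.prod (volume : Measure ℂ) A)) := by
  have hmeas : ∀ n, MeasurableSet (A ∩ fiberRotation (γ n) '' A) := fun n =>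
    hA.inter ((fiberRotation (γ n)).measurableSet_image.2 hA)
  simp_rw [Measure.prod_apply (hmeas _), Measure.prod_apply hA]
  rw [Measure.prod_apply hA] at hAfin
  refine tendsto_lintegral_of_dominated_convergence (fun y => volume (Prod.mk y ⁻¹' A))
    (fun n => measurable_measure_prodMk_left (hmeas n))
    (fun n => ae_of_all _ fun y => measure_mono fun z hz => hz.1) hAfin.ne ?_
  filter_upwards [hγ, ae_lt_top (measurable_measure_prodMk_left hA) hAfin.ne] with y hy hyA
  have hconj : Tendsto (fun n => UnitAddTorus.mFourier (-γ n) y) atTop (𝓝 1) := by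
    simp_rw [UnitAddTorus.mFourier_neg]
    simpa [Function.comp_def] using (Complex.continuous_conj.tendsto 1).comp hy
  convert tendsto_measure_inter_mul_preimage (fun n => norm_mFourier_apply (-γ n) y) hconj
    (measurable_prodMk_left hA) hyA.ne using 4 with n
  ext z
  simp only [mem_preimage, MeasurableEquiv.image_eq_preimage_symm, mem_inter_iff,
    fiberRotation_symm_apply]

/-- An open circular sector in which the quotient of any two points has real part
greater than half its modulus. -/
def sector : Set ℂ := {z | 0 < z.im ∧ z.im < z.re ∧ z.re < 1}

theorem isOpen_sector : IsOpen sector := by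
  refine (isOpen_lt continuous_const Complex.continuous_im).inter
    ((isOpen_lt Complex.continuous_im Complex.continuous_re).inter
      (isOpen_lt Complex.continuous_re continuous_const))

theorem volume_sector_pos : 0 < volume sector :=
  isOpen_sector.measure_pos volume ⟨⟨1 / 2, 1 / 4⟩, by norm_num [sector]⟩

theorem volume_sector_lt_top : volume sector < ⊤ := by
  refine (measure_mono ?_).trans_lt (measure_closedBall_lt_top (x := (0 : ℂ)) (r := 2))
  intro z hz
  obtain ⟨h1, h2, h3⟩ := hz
  rw [mem_closedBall_zero_iff]
  refine (Complex.norm_le_abs_re_add_abs_im z).trans ?_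
  rw [abs_of_pos h1, abs_of_pos (h1.trans h2)]
  linarith

theorem half_lt_re_of_mem_sector {w z : ℂ} (hw : ‖w‖ = 1) (hz : z ∈ sector)
    (hwz : w * z ∈ sector) : 1 / 2 < w.re := by
  obtain ⟨h1, h2, -⟩ := hz
  obtain ⟨h3, h4, -⟩ := hwz
  simp only [Complex.mul_im, Complex.mul_re] at h3 h4
  have hsq : w.re * w.re + w.im * w.im = 1 := by
    have := Complex.normSq_eq_norm_sq w
    rw [hw, Complex.normSq_apply] at this
    linarith
  have hs : 0 < z.re * z.re + z.im * z.im := by nlinarith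
  have h5 : 0 < (w.re - w.im) * (z.re * z.re + z.im * z.im) := by nlinarith
  have h6 : 0 < (w.re + w.im) * (z.re * z.re + z.im * z.im) := by nlinarith
  have h7 := pos_of_mul_pos_left h5 hs.le
  have h8 := pos_of_mul_pos_left h6 hs.le
  nlinarith [mul_pos h7 h8]

theorem measure_inter_fiberRotation_sector_le {d : ℕ} (ν : Measure (UnitAddTorus (Fin d)))
    [IsProbabilityMeasure ν] {γ : Fin d → ℤ} (hγ : ∫ y, UnitAddTorus.mFourier γ y ∂ν = 0) :
    ν.prod (volume : Measure ℂ) (univ ×ˢ sector ∩ fiberRotation γ '' (univ ×ˢ sector)) ≤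
      ENNReal.ofReal (3 / 4) * volume sector := by
  have hA : MeasurableSet ((univ : Set (UnitAddTorus (Fin d))) ×ˢ sector) :=
    MeasurableSet.univ.prod isOpen_sector.measurableSet
  have hbound : ∀ y, |(UnitAddTorus.mFourier γ y).re| ≤ 1 := fun y =>
    (Complex.abs_re_le_norm _).trans (norm_mFourier_apply γ y).le
  have hre : ∫ y, (UnitAddTorus.mFourier γ y).re ∂ν = 0 := by
    have := integral_re (𝕜 := ℂ) (integrable_mFourier ν γ)
    simpa [hγ] using this
  have hint : Integrable (fun y => (UnitAddTorus.mFourier γ y).re) ν :=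
    (integrable_mFourier ν γ).re
  have hlin : ∫⁻ y, ENNReal.ofReal (3 / 4 + 1 / 2 * (UnitAddTorus.mFourier γ y).re) ∂ν ≤
      ENNReal.ofReal (3 / 4) := by
    rw [← ofReal_integral_eq_lintegral_ofReal]
    · rw [integral_add (integrable_const _) (hint.const_mul _), integral_const_mul]
      simp [hre]
    · exact (integrable_const _).add (hint.const_mul _)
    · exact ae_of_all _ fun y => by
        have := (abs_le.1 (hbound y)).1
        simp only [Pi.zero_apply]
        linarith
  rw [Measure.prod_apply (hA.inter ((fiberRotation γ).measurableSet_image.2 hA))]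
  refine le_trans (lintegral_mono fun y => ?_) ((lintegral_mul_const _ (by fun_prop)).trans_le
    (mul_le_mul_left hlin _))
  by_cases h : 1 / 2 < (UnitAddTorus.mFourier γ y).re
  · refine (measure_mono fun z hz => hz.1.2).trans ?_
    calc volume sector = 1 * volume sector := (one_mul _).symm
      _ ≤ _ := by
        refine mul_le_mul_left ?_ _
        rw [ENNReal.one_le_ofReal]
        linarith
  · refine (measure_mono_null (t := ∅) ?_ measure_empty).trans_le bot_le
    rintro z ⟨hz, ⟨y', z'⟩, hz', heq⟩
    rw [fiberRotation_apply, Prod.mk.injEq] at heq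
    obtain ⟨rfl, rfl⟩ := heq
    exact h (half_lt_re_of_mem_sector (norm_mFourier_apply γ y') hz'.2 hz.2)

theorem eventually_integral_mFourier_ne_zero {d : ℕ} (ν : Measure (UnitAddTorus (Fin d)))
    [IsProbabilityMeasure ν] {γ : ℕ → Fin d → ℤ}
    (hγ : ∀ A : Set (UnitAddTorus (Fin d) × ℂ), MeasurableSet A →
      ν.prod (volume : Measure ℂ) A < ⊤ →
      Tendsto (fun n => ν.prod (volume : Measure ℂ) (A ∩ fiberRotation (γ n) '' A)) atTop
        (𝓝 (ν.prod (volume : Measure ℂ) A))) :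
    ∀ᶠ n in atTop, ∫ y, UnitAddTorus.mFourier (γ n) y ∂ν ≠ 0 := by
  have hA : ν.prod (volume : Measure ℂ) (univ ×ˢ sector) = volume sector := by simp
  have h := hγ (univ ×ˢ sector) (MeasurableSet.univ.prod isOpen_sector.measurableSet)
    (hA ▸ volume_sector_lt_top)
  rw [hA] at h
  have hlt : ENNReal.ofReal (3 / 4) * volume sector < volume sector := by
    conv_rhs => rw [← one_mul (volume sector)]
    refine ENNReal.mul_lt_mul_left volume_sector_pos.ne' volume_sector_lt_top.ne ?_
    rw [ENNReal.ofReal_lt_one]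
    norm_num
  filter_upwards [h.eventually (lt_mem_nhds hlt)] with n hn h0
  exact absurd (measure_inter_fiberRotation_sector_le ν h0) hn.not_ge

theorem zcast_add {d : ℕ} (γ γ' : Fin d → ℤ) : zcast (γ + γ') = zcast γ + zcast γ' := by
  ext i; simp [zcast]

theorem zcast_zsmul {d : ℕ} (a : ℤ) (γ : Fin d → ℤ) : zcast (a • γ) = (a : ℝ) • zcast γ := by
  ext i; simp [zcast]

theorem zcast_zero {d : ℕ} : zcast (0 : Fin d → ℤ) = 0 := by
  ext i; simp [zcast]

theorem norm_zcast_zsmul {d : ℕ} (a : ℤ) (γ : Fin d → ℤ) :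
    ‖zcast (a • γ)‖ = |(a : ℝ)| * ‖zcast γ‖ := by
  rw [zcast_zsmul, norm_smul, Real.norm_eq_abs]

theorem one_le_norm_zcast {d : ℕ} {γ : Fin d → ℤ} (hγ : γ ≠ 0) : 1 ≤ ‖zcast γ‖ := by
  obtain ⟨i, hi⟩ := Function.ne_iff.1 hγ
  refine le_trans ?_ (norm_le_pi_norm (zcast γ) i)
  rw [zcast, Real.norm_eq_abs]
  exact_mod_cast Int.one_le_abs hi

/-- The probability Haar measure of the torus. -/
def torusHaar (d : ℕ) : Measure (UnitAddTorus (Fin d)) :=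
  Measure.pi fun _ => AddCircle.haarAddCircle

instance (d : ℕ) : IsProbabilityMeasure (torusHaar d) := by
  unfold torusHaar; infer_instance

theorem integral_fourier_eq_zero {n : ℤ} (hn : n ≠ 0) :
    ∫ x : UnitAddCircle, fourier n x ∂AddCircle.haarAddCircle = 0 :=
  integral_eq_zero_of_add_right_eq_neg (fourier_add_half_inv_index hn one_pos)

theorem integral_mFourier_torusHaar {d : ℕ} (γ : Fin d → ℤ) :
    ∫ y, UnitAddTorus.mFourier γ y ∂torusHaar d = if γ = 0 then 1 else 0 := by
  split_ifs with h
  · simp [h, UnitAddTorus.mFourier_zero]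
  · obtain ⟨i, hi⟩ := Function.ne_iff.1 h
    simp only [UnitAddTorus.mFourier, ContinuousMap.coe_mk, torusHaar]
    rw [integral_fintype_prod_eq_prod (fun i (x : UnitAddCircle) => (fourier (γ i) x : ℂ))]
    exact Finset.prod_eq_zero (Finset.mem_univ i) (integral_fourier_eq_zero hi)

/-- Partial Riesz products with Fejér kernel factors `F_{N k}(v k · y)`. -/
def rieszDensity {d : ℕ} (v : ℕ → Fin d → ℤ) (N : ℕ → ℕ) : ℕ → UnitAddTorus (Fin d) → ℝ
  | 0, _ => 1
  | k + 1, y => rieszDensity v N k y *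
      ((N k : ℝ)⁻¹ * ‖∑ a ∈ Finset.range (N k), UnitAddTorus.mFourier ((a : ℤ) • v k) y‖ ^ 2)

/-- The Fourier coefficients of the partial Riesz products. -/
def rieszCoeff {d : ℕ} (v : ℕ → Fin d → ℤ) (N : ℕ → ℕ) : ℕ → (Fin d → ℤ) → ℝ
  | 0, γ => if γ = 0 then 1 else 0
  | k + 1, γ => (N k : ℝ)⁻¹ * ∑ a ∈ Finset.range (N k), ∑ b ∈ Finset.range (N k),
      rieszCoeff v N k (γ + ((a : ℤ) - b) • v k)

section Riesz

variable {d : ℕ} (v : ℕ → Fin d → ℤ) (N : ℕ → ℕ)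

theorem continuous_rieszDensity (K : ℕ) : Continuous (rieszDensity v N K) := by
  induction K with
  | zero => exact continuous_const
  | succ K ih => exact ih.mul (by fun_prop)

theorem rieszDensity_nonneg (K : ℕ) (y : UnitAddTorus (Fin d)) : 0 ≤ rieszDensity v N K y := by
  induction K with
  | zero => exact zero_le_one
  | succ K ih => unfold rieszDensity; positivity

theorem norm_sq_sum_mFourier (n : ℕ) (w : Fin d → ℤ) (y : UnitAddTorus (Fin d)) :
    ((‖∑ a ∈ Finset.range n, UnitAddTorus.mFourier ((a : ℤ) • w) y‖ ^ 2 : ℝ) : ℂ) =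
      ∑ a ∈ Finset.range n, ∑ b ∈ Finset.range n,
        UnitAddTorus.mFourier (((a : ℤ) - b) • w) y := by
  push_cast
  rw [← Complex.mul_conj', map_sum, Finset.sum_mul_sum]
  simp_rw [← UnitAddTorus.mFourier_neg, ← UnitAddTorus.mFourier_add, sub_smul, sub_eq_add_neg]

theorem integral_rieszDensity_mul_mFourier (K : ℕ) (γ : Fin d → ℤ) :
    ∫ y, (rieszDensity v N K y : ℂ) * UnitAddTorus.mFourier γ y ∂torusHaar d =
      rieszCoeff v N K γ := by
  induction K generalizing γ with
  | zero => simp [rieszDensity, rieszCoeff, integral_mFourier_torusHaar, apply_ite Complex.ofReal]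
  | succ K ih =>
    have hint : ∀ γ', Integrable (fun y => (rieszDensity v N K y : ℂ) *
        UnitAddTorus.mFourier γ' y) (torusHaar d) := fun γ' =>
      Continuous.integrable_of_hasCompactSupport
        (by have := continuous_rieszDensity v N K; fun_prop) (.of_compactSpace _)
    have hexp : ∀ y, (rieszDensity v N (K + 1) y : ℂ) * UnitAddTorus.mFourier γ y =
        (N K : ℂ)⁻¹ * ∑ a ∈ Finset.range (N K), ∑ b ∈ Finset.range (N K),
          (rieszDensity v N K y : ℂ) *
            UnitAddTorus.mFourier (γ + ((a : ℤ) - b) • v K) y := by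
      intro y
      rw [rieszDensity, Complex.ofReal_mul, Complex.ofReal_mul, norm_sq_sum_mFourier]
      simp_rw [UnitAddTorus.mFourier_add, ← mul_assoc, ← Finset.mul_sum]
      push_cast
      ring
    simp_rw [hexp]
    rw [integral_const_mul, integral_finsetSum _ fun a _ => integrable_finsetSum _ fun b _ => hint _]
    simp_rw [integral_finsetSum (Finset.range (N K)) fun b _ => hint _, ih]
    simp [rieszCoeff]

theorem rieszCoeff_nonneg (K : ℕ) (γ : Fin d → ℤ) : 0 ≤ rieszCoeff v N K γ := by
  induction K generalizing γ with
  | zero => unfold rieszCoeff; positivity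
  | succ K ih =>
    unfold rieszCoeff
    exact mul_nonneg (by positivity) (Finset.sum_nonneg fun a _ => Finset.sum_nonneg fun b _ => ih _)

variable {N}

theorem rieszCoeff_le_succ (hN : ∀ k, 1 ≤ N k) (K : ℕ) (γ : Fin d → ℤ) :
    rieszCoeff v N K γ ≤ rieszCoeff v N (K + 1) γ := by
  have hpos : (0 : ℝ) < N K := by exact_mod_cast hN K
  rw [rieszCoeff, le_inv_mul_iff₀ hpos]
  calc (N K : ℝ) * rieszCoeff v N K γ
      = ∑ a ∈ Finset.range (N K), rieszCoeff v N K (γ + ((a : ℤ) - a) • v K) := by simp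
    _ ≤ _ := Finset.sum_le_sum fun a ha =>
      Finset.single_le_sum (f := fun b : ℕ => rieszCoeff v N K (γ + ((a : ℤ) - b) • v K))
        (fun b _ => rieszCoeff_nonneg v N K _) ha

theorem one_sub_inv_le_rieszCoeff (hN : ∀ k, 1 ≤ N k) (K : ℕ) (h0 : rieszCoeff v N K 0 = 1) :
    1 - (N K : ℝ)⁻¹ ≤ rieszCoeff v N (K + 1) (v K) := by
  have hpos : (0 : ℝ) < N K := by exact_mod_cast hN K
  rw [rieszCoeff, le_inv_mul_iff₀ hpos, mul_sub, mul_inv_cancel₀ hpos.ne', mul_one]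
  obtain ⟨n, hn⟩ : ∃ n, N K = n + 1 := ⟨N K - 1, by have := hN K; omega⟩
  calc (N K : ℝ) - 1 = ∑ a ∈ Finset.range n, (1 : ℝ) := by simp [hn]
    _ ≤ ∑ a ∈ Finset.range n, ∑ b ∈ Finset.range (N K),
          rieszCoeff v N K (v K + ((a : ℤ) - b) • v K) := by
        refine Finset.sum_le_sum fun a ha => ?_
        refine le_trans ?_ (Finset.single_le_sum
          (f := fun b : ℕ => rieszCoeff v N K (v K + ((a : ℤ) - b) • v K))
          (fun b _ => rieszCoeff_nonneg v N K _) (a := a + 1) ?_)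
        · simp [← h0]
        · rw [Finset.mem_range] at ha ⊢
          omega
    _ ≤ _ := by
        refine Finset.sum_le_sum_of_subset_of_nonneg (fun a ha => ?_) fun a _ _ =>
          Finset.sum_nonneg fun b _ => rieszCoeff_nonneg v N K _
        rw [Finset.mem_range] at ha ⊢
        omega

/-- Integer vectors of the form `a v_k + r` with `k < K`, `0 < |a| ≤ N k`, `‖r‖ ≤ R k`,
together with zero. -/
def spectrumBound (N : ℕ → ℕ) (R : ℕ → ℝ) (K : ℕ) : Set (Fin d → ℤ) :=
  {γ | γ = 0 ∨ ∃ k < K, ∃ a : ℤ, a ≠ 0 ∧ |a| ≤ N k ∧ ∃ r, ‖zcast r‖ ≤ R k ∧ γ = a • v k + r}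

variable {v} {R : ℕ → ℝ}

theorem norm_zsmul_add_le (hR : ∀ k, R (k + 1) = R k + N k * ‖zcast (v k)‖) {k : ℕ} {a : ℤ}
    (ha : |a| ≤ N k) {r : Fin d → ℤ} (hr : ‖zcast r‖ ≤ R k) :
    ‖zcast (a • v k + r)‖ ≤ R (k + 1) := by
  rw [zcast_add, hR, add_comm (R k)]
  refine (norm_add_le _ _).trans (add_le_add ?_ hr)
  rw [norm_zcast_zsmul]
  gcongr
  exact_mod_cast ha

theorem norm_le_of_mem_spectrumBound (h0 : 0 ≤ R 0)
    (hR : ∀ k, R (k + 1) = R k + N k * ‖zcast (v k)‖) {K : ℕ} {γ : Fin d → ℤ}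
    (hγ : γ ∈ spectrumBound v N R K) : ‖zcast γ‖ ≤ R K := by
  have hmono : Monotone R := monotone_nat_of_le_succ fun k => by
    rw [hR]; exact le_add_of_nonneg_right (by positivity)
  obtain rfl | ⟨k, hk, a, -, ha, r, hr, rfl⟩ := hγ
  · rw [zcast_zero, norm_zero]
    exact h0.trans (hmono (Nat.zero_le K))
  · exact (norm_zsmul_add_le hR ha hr).trans (hmono hk)

theorem mem_spectrumBound_of_rieszCoeff_ne_zero (h0 : 0 ≤ R 0)
    (hR : ∀ k, R (k + 1) = R k + N k * ‖zcast (v k)‖) {K : ℕ} {γ : Fin d → ℤ}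
    (hγ : rieszCoeff v N K γ ≠ 0) : γ ∈ spectrumBound v N R K := by
  induction K generalizing γ with
  | zero => exact Or.inl (by simpa [rieszCoeff] using hγ)
  | succ K ih =>
    rw [rieszCoeff] at hγ
    obtain ⟨a, ha, hγ⟩ := Finset.exists_ne_zero_of_sum_ne_zero (right_ne_zero_of_mul hγ)
    obtain ⟨b, hb, hγ⟩ := Finset.exists_ne_zero_of_sum_ne_zero hγ
    rw [Finset.mem_range] at ha hb
    have hmem := ih hγ
    by_cases hab : a = b
    · subst hab
      rw [sub_self, zero_smul, add_zero] at hmem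
      refine hmem.imp id ?_
      rintro ⟨k, hk, h⟩
      exact ⟨k, hk.trans (Nat.lt_succ_self K), h⟩
    · refine Or.inr ⟨K, Nat.lt_succ_self K, (b : ℤ) - a, by omega, ?_, _,
        norm_le_of_mem_spectrumBound h0 hR hmem, ?_⟩
      · rw [abs_le]; omega
      · rw [add_comm γ, ← add_assoc, ← add_smul]
        simp

theorem rieszCoeff_zero_eq_one (hN : ∀ k, 1 ≤ N k) (h0 : 0 ≤ R 0)
    (hR : ∀ k, R (k + 1) = R k + N k * ‖zcast (v k)‖) (hv : ∀ k, R k < ‖zcast (v k)‖) (K : ℕ) :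
    rieszCoeff v N K 0 = 1 := by
  induction K with
  | zero => simp [rieszCoeff]
  | succ K ih =>
    have hpos : (0 : ℝ) < N K := by exact_mod_cast hN K
    rw [rieszCoeff, inv_mul_eq_one₀ hpos.ne']
    calc (N K : ℝ) = ∑ a ∈ Finset.range (N K), (1 : ℝ) := by simp
      _ = _ := by
        refine Finset.sum_congr rfl fun a ha => ?_
        rw [Finset.sum_eq_single_of_mem a ha]
        · simp [ih]
        · intro b _ hba
          by_contra h
          have hle := norm_le_of_mem_spectrumBound h0 hR
            (mem_spectrumBound_of_rieszCoeff_ne_zero h0 hR h)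
          rw [zero_add, norm_zcast_zsmul] at hle
          have h1 : (1 : ℝ) ≤ |(((a : ℤ) - b : ℤ) : ℝ)| := by
            have hne : (a : ℤ) - b ≠ 0 := by omega
            exact_mod_cast Int.one_le_abs hne
          nlinarith [hv K, norm_nonneg (zcast (v K))]

theorem exists_riesz_measure (hN : ∀ k, 1 ≤ N k) (h0 : 0 ≤ R 0)
    (hR : ∀ k, R (k + 1) = R k + N k * ‖zcast (v k)‖) (hv : ∀ k, R k < ‖zcast (v k)‖) :
    ∃ ν : Measure (UnitAddTorus (Fin d)), IsProbabilityMeasure ν ∧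
      (∀ γ, (∀ K, γ ∉ spectrumBound v N R K) → ∫ y, UnitAddTorus.mFourier γ y ∂ν = 0) ∧
      ∀ k, 1 - (N k : ℝ)⁻¹ ≤ (∫ y, UnitAddTorus.mFourier (v k) y ∂ν).re := by
  have hc0 := rieszCoeff_zero_eq_one hN h0 hR hv
  have hdens : ∀ K γ, ∫ y, UnitAddTorus.mFourier γ y
      ∂((torusHaar d).withDensity fun y => ENNReal.ofReal (rieszDensity v N K y)) =
      rieszCoeff v N K γ := by
    intro K γ
    rw [integral_withDensity_eq_integral_toReal_smul
      (continuous_rieszDensity v N K).measurable.ennreal_ofReal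
      (ae_of_all _ fun _ => ENNReal.ofReal_lt_top), ← integral_rieszDensity_mul_mFourier]
    simp [ENNReal.toReal_ofReal (rieszDensity_nonneg v N K _)]
  have hprob : ∀ K, IsProbabilityMeasure
      ((torusHaar d).withDensity fun y => ENNReal.ofReal (rieszDensity v N K y)) := by
    intro K
    refine ⟨?_⟩
    rw [withDensity_apply _ MeasurableSet.univ, setLIntegral_univ,
      ← ofReal_integral_eq_lintegral_ofReal]
    · have := integral_rieszDensity_mul_mFourier v N K 0
      simp only [UnitAddTorus.mFourier_zero, ContinuousMap.one_apply, mul_one, hc0,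
        integral_complex_ofReal] at this
      rw [Complex.ofReal_inj.1 this, ENNReal.ofReal_one]
    · exact (continuous_rieszDensity v N K).integrable_of_hasCompactSupport (.of_compactSpace _)
    · exact ae_of_all _ (rieszDensity_nonneg v N K)
  let P : ℕ → ProbabilityMeasure (UnitAddTorus (Fin d)) := fun K => ⟨_, hprob K⟩
  obtain ⟨ν, -, hν⟩ := isCompact_univ.ultrafilter_le_nhds ((hyperfilter ℕ).map P) (by simp)
  have hlim : ∀ γ, Tendsto (fun K => (rieszCoeff v N K γ : ℂ)) (hyperfilter ℕ)
      (𝓝 (∫ y, UnitAddTorus.mFourier γ y ∂(ν : Measure (UnitAddTorus (Fin d))))) := by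
    intro γ
    have := (ProbabilityMeasure.tendsto_iff_forall_integral_rclike_tendsto ℂ).1
      (show Tendsto P (hyperfilter ℕ) (𝓝 ν) from hν)
      (BoundedContinuousFunction.mkOfCompact (UnitAddTorus.mFourier γ))
    simpa [P, hdens] using this
  refine ⟨ν, inferInstance, fun γ hγ => ?_, fun k => ?_⟩
  · have hzero : ∀ K, rieszCoeff v N K γ = 0 := fun K => by
      by_contra h
      exact hγ K (mem_spectrumBound_of_rieszCoeff_ne_zero h0 hR h)
    have := hlim γ
    simp only [hzero, Complex.ofReal_zero] at this
    exact tendsto_nhds_unique this tendsto_const_nhds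
  · have hre := (Complex.continuous_re.tendsto _).comp (hlim (v k))
    refine ge_of_tendsto hre ?_
    refine Nat.hyperfilter_le_atTop ((eventually_ge_atTop (k + 1)).mono fun K hK => ?_)
    exact (one_sub_inv_le_rieszCoeff v hN k (hc0 k)).trans
      (monotone_nat_of_le_succ (f := fun K => rieszCoeff v N K (v k))
        (fun K => rieszCoeff_le_succ v hN K _) hK)

end Riesz

theorem mFourier_zsmul_apply {d : ℕ} (a : ℤ) (γ : Fin d → ℤ) (y : UnitAddTorus (Fin d)) :
    UnitAddTorus.mFourier (a • γ) y = UnitAddTorus.mFourier γ y ^ a := by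
  simp [UnitAddTorus.mFourier, fourier_apply, mul_smul, AddCircle.toCircle_zsmul,
    Finset.prod_zpow]

theorem measure_mFourier_eq_one_eq_zero {d : ℕ} (ν : Measure (UnitAddTorus (Fin d)))
    [IsProbabilityMeasure ν] {γ : Fin d → ℤ}
    (h : ∀ m : ℕ, ∃ q : ℤ, ∀ i : ℤ, i ≠ 0 → |i| < m →
      ∫ y, UnitAddTorus.mFourier (i • q • γ) y ∂ν = 0) :
    ν {y | UnitAddTorus.mFourier γ y = 1} = 0 := by
  have hbound : ∀ m : ℕ, (m : ℝ) * ν.real {y | UnitAddTorus.mFourier γ y = 1} ≤ 1 := by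
    intro m
    obtain rfl | hm := Nat.eq_zero_or_pos m
    · simp
    obtain ⟨q, hq⟩ := h m
    let f : UnitAddTorus (Fin d) → ℝ := fun y =>
      ‖∑ a ∈ Finset.range m, UnitAddTorus.mFourier ((a : ℤ) • q • γ) y‖ ^ 2
    have hf : ∫ y, f y ∂ν = m := by
      rw [← Complex.ofReal_inj, ← integral_complex_ofReal]
      simp_rw [f, norm_sq_sum_mFourier]
      rw [integral_finsetSum _ fun a _ => integrable_finsetSum _ fun b _ =>
        integrable_mFourier ν _]
      simp_rw [integral_finsetSum (Finset.range m) fun b _ => integrable_mFourier ν _]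
      calc _ = ∑ a ∈ Finset.range m, (1 : ℂ) := by
            refine Finset.sum_congr rfl fun a ha => ?_
            rw [Finset.sum_eq_single_of_mem a ha]
            · simp [UnitAddTorus.mFourier_zero]
            · intro b hb hba
              rw [Finset.mem_range] at ha hb
              exact hq _ (by omega) (by rw [abs_lt]; omega)
        _ = _ := by simp
    have hfint : Integrable f ν :=
      Continuous.integrable_of_hasCompactSupport (by fun_prop) (.of_compactSpace _)
    have hmarkov := mul_meas_ge_le_integral_of_nonneg
      (ae_of_all ν fun y => (sq_nonneg _ : 0 ≤ f y)) hfint ((m : ℝ) ^ 2)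
    have hsub : ν.real {y | UnitAddTorus.mFourier γ y = 1} ≤ ν.real {y | (m : ℝ) ^ 2 ≤ f y} := by
      refine measureReal_mono fun y hy => ?_
      have hy' : UnitAddTorus.mFourier γ y = 1 := hy
      simp only [f, mem_ofPred_eq, mFourier_zsmul_apply, hy', one_zpow]
      simp
    have hm' : (0 : ℝ) < m := by exact_mod_cast hm
    rw [hf] at hmarkov
    nlinarith [mul_le_mul_of_nonneg_left hsub (sq_nonneg (m : ℝ))]
  rw [← measureReal_eq_zero_iff]
  by_contra hne
  have hpos := lt_of_le_of_ne measureReal_nonneg (Ne.symm hne)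
  obtain ⟨m, hm⟩ := exists_nat_gt (ν.real {y | UnitAddTorus.mFourier γ y = 1})⁻¹
  rw [inv_lt_iff_one_lt_mul₀ hpos] at hm
  linarith [hbound m]

theorem ae_tendsto_mFourier_one {d : ℕ} (ν : Measure (UnitAddTorus (Fin d)))
    [IsProbabilityMeasure ν] {v : ℕ → Fin d → ℤ}
    (hv : ∀ k, 1 - ((2 : ℝ) ^ k)⁻¹ ≤ (∫ y, UnitAddTorus.mFourier (v k) y ∂ν).re) :
    ∀ᵐ y ∂ν, Tendsto (fun k => UnitAddTorus.mFourier (v k) y) atTop (𝓝 1) := by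
  have hle : ∀ k y, (UnitAddTorus.mFourier (v k) y).re ≤ 1 := fun k y =>
    (Complex.re_le_norm _).trans (norm_mFourier_apply (v k) y).le
  have hlint : ∀ k, ∫⁻ y, ENNReal.ofReal (1 - (UnitAddTorus.mFourier (v k) y).re) ∂ν ≤
      ENNReal.ofReal ((2⁻¹ : ℝ) ^ k) := by
    intro k
    have hint : Integrable (fun y => (UnitAddTorus.mFourier (v k) y).re) ν :=
      (integrable_mFourier ν (v k)).re
    have hsub : Integrable (fun y => 1 - (UnitAddTorus.mFourier (v k) y).re) ν :=
      (integrable_const _).sub hint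
    rw [← ofReal_integral_eq_lintegral_ofReal hsub
      (ae_of_all _ fun y => sub_nonneg.2 (hle k y)), integral_sub (integrable_const _) hint]
    refine ENNReal.ofReal_le_ofReal ?_
    have hre : ∫ y, (UnitAddTorus.mFourier (v k) y).re ∂ν =
        (∫ y, UnitAddTorus.mFourier (v k) y ∂ν).re :=
      integral_re (𝕜 := ℂ) (integrable_mFourier ν (v k))
    rw [hre, inv_pow]
    simpa using by linarith [hv k]
  have hsum : ∫⁻ y, ∑' k, ENNReal.ofReal (1 - (UnitAddTorus.mFourier (v k) y).re) ∂ν ≠ ⊤ := by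
    rw [lintegral_tsum fun k => by fun_prop]
    refine ne_top_of_le_ne_top ?_ (ENNReal.tsum_le_tsum hlint)
    rw [← ENNReal.ofReal_tsum_of_nonneg (fun k => by positivity)
      (summable_geometric_of_lt_one (by norm_num) (by norm_num))]
    exact ENNReal.ofReal_ne_top
  filter_upwards [ae_lt_top (by fun_prop) hsum] with y hy
  have h0 := ENNReal.tendsto_atTop_zero_of_tsum_ne_top hy.ne
  have h1 : Tendsto (fun k => 1 - (UnitAddTorus.mFourier (v k) y).re) atTop (𝓝 0) := by
    have := (ENNReal.tendsto_toReal ENNReal.zero_ne_top).comp h0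
    refine this.congr fun k => ?_
    exact ENNReal.toReal_ofReal (sub_nonneg.2 (hle k y))
  rw [tendsto_iff_norm_sub_tendsto_zero]
  have h2 : Tendsto (fun k => √(2 * (1 - (UnitAddTorus.mFourier (v k) y).re))) atTop (𝓝 0) := by
    simpa using (h1.const_mul 2).sqrt
  refine h2.congr fun k => ?_
  rw [Real.sqrt_eq_iff_mul_self_eq (by linarith [hle k y]) (norm_nonneg _)]
  have hn := Complex.normSq_eq_norm_sq (UnitAddTorus.mFourier (v k) y)
  rw [norm_mFourier_apply, Complex.normSq_apply] at hn
  rw [← sq, ← Complex.normSq_eq_norm_sq, Complex.normSq_apply]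
  simp only [Complex.sub_re, Complex.one_re, Complex.sub_im, Complex.one_im]
  linarith

theorem exists_nat_smul_near_int {d : ℕ} (u : Fin d → ℝ) {ε : ℝ} (hε : 0 < ε) (n₀ : ℕ) :
    ∃ n ≥ n₀, ∃ v : Fin d → ℤ, ‖zcast v - (n : ℝ) • u‖ < ε := by
  let x : UnitAddTorus (Fin d) := fun i => (u i : UnitAddCircle)
  have hx := (mapClusterPt_zero_atTop_nsmul x).frequently (Metric.ball_mem_nhds 0 hε)
  obtain ⟨n, hn, hn₀⟩ := (hx.and_eventually (eventually_ge_atTop n₀)).exists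
  refine ⟨n, hn₀, fun i => round ((n : ℝ) * u i), ?_⟩
  rw [dist_zero_right, pi_norm_lt_iff hε] at hn
  rw [pi_norm_lt_iff hε]
  intro i
  have hi := hn i
  have hxi : (n • x) i = (((n : ℝ) * u i : ℝ) : UnitAddCircle) := by
    simp [x, ← nsmul_eq_mul]
  rw [hxi, UnitAddCircle.norm_eq] at hi
  simpa [zcast, Real.norm_eq_abs, abs_sub_comm] using hi

theorem mk_eq_of_mem_submodule {d : ℕ} {θ : Projectivization ℝ (Fin d → ℝ)} {w : Fin d → ℝ}
    (hw : w ∈ θ.submodule) (hw0 : w ≠ 0) : Projectivization.mk ℝ w hw0 = θ := by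
  rw [Projectivization.submodule_eq, Submodule.mem_span_singleton] at hw
  obtain ⟨a, rfl⟩ := hw
  conv_rhs => rw [← θ.mk_rep]
  rw [Projectivization.mk_eq_mk_iff']
  exact ⟨a, rfl⟩

theorem exists_unit_mem_submodule {d : ℕ} (θ : Projectivization ℝ (Fin d → ℝ)) :
    ∃ u ∈ θ.submodule, ‖u‖ = 1 := by
  refine ⟨‖θ.rep‖⁻¹ • θ.rep, ?_, ?_⟩
  · rw [Projectivization.submodule_eq]
    exact Submodule.smul_mem _ _ (Submodule.mem_span_singleton_self _)
  · rw [norm_smul, norm_inv, norm_norm, inv_mul_cancel₀ (norm_ne_zero_iff.2 θ.rep_nonzero)]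

theorem exists_ball_mk_mem {d : ℕ} {U : Set (Projectivization ℝ (Fin d → ℝ))} (hU : IsOpen U)
    {u : Fin d → ℝ} (hu : u ≠ 0) (huU : Projectivization.mk ℝ u hu ∈ U) :
    ∃ δ > 0, ∀ (w : Fin d → ℝ) (hw : w ≠ 0), ‖w - u‖ < δ → Projectivization.mk ℝ w hw ∈ U := by
  have hcont : Continuous fun w : {w : Fin d → ℝ // w ≠ 0} => Projectivization.mk ℝ w.1 w.2 :=
    continuous_coinduced_rng
  obtain ⟨δ, hδ, hball⟩ := Metric.isOpen_iff.1 (hU.preimage hcont) ⟨u, hu⟩ huU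
  refine ⟨δ, hδ, fun w hw hwu => hball (a := ⟨w, hw⟩) ?_⟩
  rwa [Metric.mem_ball, Subtype.dist_eq, dist_eq_norm]

theorem exists_int_near_line {d : ℕ} {U : Set (Projectivization ℝ (Fin d → ℝ))} (hU : IsOpen U)
    {θ : Projectivization ℝ (Fin d → ℝ)} (hθ : θ ∈ U) {ε : ℝ} (hε : 0 < ε) (L : ℝ) :
    ∃ v : Fin d → ℤ, Metric.infDist (zcast v) (θ.submodule : Set (Fin d → ℝ)) < ε ∧
      L ≤ ‖zcast v‖ ∧
      ∀ θ' ∉ U, L ≤ Metric.infDist (zcast v) (θ'.submodule : Set (Fin d → ℝ)) := by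
  obtain ⟨u, huθ, hu1⟩ := exists_unit_mem_submodule θ
  have hu0 : u ≠ 0 := norm_ne_zero_iff.1 (by rw [hu1]; exact one_ne_zero)
  obtain ⟨δ, hδ, hball⟩ := exists_ball_mk_mem hU hu0 (by rwa [mk_eq_of_mem_submodule huθ hu0])
  obtain ⟨n₀, hn₀⟩ := exists_nat_ge (max 1 (max (|L| + 1) ((|L| + 1) / δ)))
  obtain ⟨n, hn, v, hv⟩ := exists_nat_smul_near_int u (lt_min hε one_pos) n₀
  have hnn : max 1 (max (|L| + 1) ((|L| + 1) / δ)) ≤ n := hn₀.trans (by exact_mod_cast hn)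
  simp only [max_le_iff, div_le_iff₀ hδ] at hnn
  obtain ⟨hn1, hnL, hnδ⟩ := hnn
  obtain ⟨hvε, hv1⟩ := lt_min_iff.1 hv
  have hnu : ‖(n : ℝ) • u‖ = n := by rw [norm_smul, hu1]; simp
  have hnpos : (0 : ℝ) < n := one_pos.trans_le hn1
  refine ⟨v, ?_, ?_, fun θ' hθ' => ?_⟩
  · refine (Metric.infDist_le_dist_of_mem (θ.submodule.smul_mem (n : ℝ) huθ)).trans_lt ?_
    rwa [dist_eq_norm]
  · have := norm_sub_norm_le ((n : ℝ) • u) (zcast v)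
    rw [norm_sub_rev, hnu] at this
    linarith [le_abs_self L]
  · by_contra! hlt
    obtain ⟨w, hw, hvw⟩ := (Metric.infDist_lt_iff ⟨0, θ'.submodule.zero_mem⟩).1 hlt
    rw [dist_eq_norm, norm_sub_rev] at hvw
    have hwn : ‖w - (n : ℝ) • u‖ < |L| + 1 := by
      have := norm_sub_le_norm_sub_add_norm_sub w (zcast v) ((n : ℝ) • u)
      linarith [le_abs_self L]
    have hw0 : w ≠ 0 := by
      rintro rfl
      rw [zero_sub, norm_neg, hnu] at hwn
      linarith
    have hs0 : (n : ℝ)⁻¹ • w ≠ 0 := smul_ne_zero (inv_ne_zero hnpos.ne') hw0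
    refine hθ' ?_
    rw [← mk_eq_of_mem_submodule (θ'.submodule.smul_mem (n : ℝ)⁻¹ hw) hs0]
    refine hball _ hs0 ?_
    have : (n : ℝ)⁻¹ • w - u = (n : ℝ)⁻¹ • (w - (n : ℝ) • u) := by
      rw [smul_sub, inv_smul_smul₀ hnpos.ne']
    rw [this, norm_smul, norm_inv, Real.norm_natCast, inv_mul_lt_iff₀ hnpos]
    linarith

theorem exists_action_of_measure {d : ℕ} {Δ D : Set (Projectivization ℝ (Fin d → ℝ))}
    (ν : Measure (UnitAddTorus (Fin d))) [IsProbabilityMeasure ν]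
    (hfree : ∀ γ : Fin d → ℤ, γ ≠ 0 → ν {y | UnitAddTorus.mFourier γ y = 1} = 0)
    (hD : ∀ θ ∈ D, ∃ γ : ℕ → Fin d → ℤ, Tendsto (fun n => ‖zcast (γ n)‖) atTop atTop ∧
      Tendsto (fun n => Metric.infDist (zcast (γ n)) (θ.submodule : Set (Fin d → ℝ))) atTop (𝓝 0) ∧
      ∀ᵐ y ∂ν, Tendsto (fun n => UnitAddTorus.mFourier (γ n) y) atTop (𝓝 1))
    (hΔ : ∀ θ ∉ Δ, ∀ γ : ℕ → Fin d → ℤ, Tendsto (fun n => ‖zcast (γ n)‖) atTop atTop →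
      Tendsto (fun n => Metric.infDist (zcast (γ n)) (θ.submodule : Set (Fin d → ℝ))) atTop (𝓝 0) →
      ¬ ∀ᶠ n in atTop, ∫ y, UnitAddTorus.mFourier (γ n) y ∂ν ≠ 0) :
    ∃ (X : Type) (_ : MeasurableSpace X), StandardBorelSpace X ∧
      ∃ μ : Measure X, SigmaFinite μ ∧ μ Set.univ = ⊤ ∧
        ∃ T : (Fin d → ℤ) → X ≃ᵐ X, IsMPAction μ T ∧ IsFreeAction μ T ∧
          D ⊆ rigSet μ T ∧ rigSet μ T ⊆ Δ := by
  refine ⟨UnitAddTorus (Fin d) × ℂ, inferInstance, inferInstance, ν.prod volume, inferInstance,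
    ?_, fiberRotation, isMPAction_fiberRotation ν, isFreeAction_fiberRotation ν hfree, ?_, ?_⟩
  · rw [← univ_prod_univ, Measure.prod_prod, measure_univ, one_mul]
    exact measure_univ_of_isAddLeftInvariant volume
  · intro θ hθ
    obtain ⟨γ, h1, h2, h3⟩ := hD θ hθ
    exact ⟨γ, h1, h2, fun A hA hAfin => tendsto_measure_inter_fiberRotation ν h3 hA hAfin⟩
  · rintro θ ⟨γ, h1, h2, h3⟩
    by_contra hθ
    exact hΔ θ hθ γ h1 h2 (eventually_integral_mFourier_ne_zero ν h3)

theorem exists_action_without_rigid_directions {d : ℕ}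
    (Δ : Set (Projectivization ℝ (Fin d → ℝ))) :
    ∃ (X : Type) (_ : MeasurableSpace X), StandardBorelSpace X ∧
      ∃ μ : Measure X, SigmaFinite μ ∧ μ Set.univ = ⊤ ∧
        ∃ T : (Fin d → ℤ) → X ≃ᵐ X, IsMPAction μ T ∧ IsFreeAction μ T ∧
          ∅ ⊆ rigSet μ T ∧ rigSet μ T ⊆ Δ := by
  refine exists_action_of_measure (torusHaar d) (fun γ hγ => ?_) (by simp)
    fun θ _ γ hγ _ hne => ?_
  · refine measure_mFourier_eq_one_eq_zero _ fun m => ⟨1, fun i hi _ => ?_⟩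
    rw [integral_mFourier_torusHaar, one_smul, if_neg (smul_ne_zero hi hγ)]
  · obtain ⟨n, hn, hn0⟩ := ((hγ.eventually_gt_atTop 0).and hne).exists
    rw [integral_mFourier_torusHaar] at hn0
    refine hn0 (if_neg fun h => ?_)
    rw [h, zcast_zero, norm_zero] at hn
    exact hn.false

theorem zsmul_not_mem_spectrumBound {d : ℕ} {v : ℕ → Fin d → ℤ} {N : ℕ → ℕ} {R : ℕ → ℝ}
    (h0 : 0 ≤ R 0) (hR : ∀ k, R (k + 1) = R k + N k * ‖zcast (v k)‖)
    (hgap : ∀ k : ℕ, R k + 1 + (k : ℝ) ^ 2 * (R k + 2) ≤ ‖zcast (v k)‖)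
    {γ : Fin d → ℤ} (hγ : γ ≠ 0) (m : ℕ) :
    ∃ q : ℤ, ∀ i : ℤ, i ≠ 0 → |i| < m → ∀ K, i • q • γ ∉ spectrumBound v N R K := by
  have hmono : Monotone R := monotone_nat_of_le_succ fun k => by
    rw [hR]; exact le_add_of_nonneg_right (by positivity)
  have hnonneg : ∀ k, 0 ≤ R k := fun k => h0.trans (hmono (Nat.zero_le k))
  obtain ⟨k₀, hk₀⟩ := exists_nat_ge ‖zcast γ‖
  set k := max m k₀
  have hmk : (m : ℝ) ≤ k := by exact_mod_cast le_max_left m k₀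
  have hγk : ‖zcast γ‖ ≤ k := hk₀.trans (by exact_mod_cast le_max_right m k₀)
  refine ⟨(⌈R k⌉₊ : ℤ) + 1, fun i hi him K hmem => ?_⟩
  have hi1 : (1 : ℝ) ≤ |(i : ℝ)| := by exact_mod_cast Int.one_le_abs hi
  have him' : |(i : ℝ)| ≤ m := by exact_mod_cast him.le
  have hγ1 := one_le_norm_zcast hγ
  have hc1 := Nat.le_ceil (R k)
  have hc2 := (Nat.ceil_lt_add_one (hnonneg k)).le
  set c : ℝ := (⌈R k⌉₊ : ℝ) + 1
  have hnorm : ‖zcast (i • ((⌈R k⌉₊ : ℤ) + 1) • γ)‖ = |(i : ℝ)| * (c * ‖zcast γ‖) := by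
    rw [norm_zcast_zsmul, norm_zcast_zsmul]
    push_cast
    rw [abs_of_nonneg (by positivity : (0 : ℝ) ≤ (⌈R k⌉₊ : ℝ) + 1)]
  have hcpos : 0 < c := by linarith [hnonneg k]
  have hlow : R k < |(i : ℝ)| * (c * ‖zcast γ‖) := by
    calc R k < c := by linarith
      _ = 1 * (c * 1) := by ring
      _ ≤ _ := by gcongr
  have hhigh : |(i : ℝ)| * (c * ‖zcast γ‖) ≤ (k : ℝ) ^ 2 * (R k + 2) := by
    calc |(i : ℝ)| * (c * ‖zcast γ‖) ≤ k * ((R k + 2) * k) := by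
          gcongr
          · linarith [hnonneg k]
          · linarith
          · linarith
      _ = _ := by ring
  obtain h | ⟨j, -, a, ha0, ha, r, hr, heq⟩ := hmem
  · rw [h, zcast_zero, norm_zero] at hnorm
    linarith [hnonneg k]
  · obtain hjk | hkj := lt_or_ge j k
    · have := (norm_zsmul_add_le hR ha hr).trans (hmono hjk)
      rw [← heq, hnorm] at this
      linarith
    · have h1 : (1 : ℝ) ≤ |(a : ℝ)| := by exact_mod_cast Int.one_le_abs ha0
      have h2 : ‖zcast (a • v j)‖ - ‖zcast r‖ ≤ ‖zcast (a • v j + r)‖ := by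
        rw [zcast_add]
        exact norm_sub_le_norm_add _ _
      rw [← heq, hnorm, norm_zcast_zsmul] at h2
      have h3 : (k : ℝ) ^ 2 * (R k + 2) ≤ (j : ℝ) ^ 2 * (R j + 2) := by
        have := hmono hkj
        have := hnonneg k
        gcongr
      nlinarith [hgap j, norm_nonneg (zcast (v j))]

theorem le_infDist_zsmul_add {d : ℕ} (θ : Projectivization ℝ (Fin d → ℝ)) {v r : Fin d → ℤ}
    {a : ℤ} (ha : a ≠ 0) :
    Metric.infDist (zcast v) (θ.submodule : Set (Fin d → ℝ)) - ‖zcast r‖ ≤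
      Metric.infDist (zcast (a • v + r)) (θ.submodule : Set (Fin d → ℝ)) := by
  have ha' : (a : ℝ) ≠ 0 := by exact_mod_cast ha
  have h1 : (1 : ℝ) ≤ |(a : ℝ)| := by exact_mod_cast Int.one_le_abs ha
  refine (Metric.le_infDist ⟨0, θ.submodule.zero_mem⟩).2 fun w hw => ?_
  have h2 := Metric.infDist_le_dist_of_mem (x := zcast v)
    (θ.submodule.smul_mem (a : ℝ)⁻¹ hw)
  have h3 : ‖(a : ℝ) • zcast v - w‖ = |(a : ℝ)| * dist (zcast v) ((a : ℝ)⁻¹ • w) := by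
    rw [dist_eq_norm, ← Real.norm_eq_abs, ← norm_smul, smul_sub, smul_inv_smul₀ ha']
  have h4 : dist (zcast v) ((a : ℝ)⁻¹ • w) ≤ ‖(a : ℝ) • zcast v - w‖ := by
    rw [h3]
    exact le_mul_of_one_le_left dist_nonneg h1
  have h5 : ‖(a : ℝ) • zcast v - w‖ ≤ dist (zcast (a • v + r)) w + ‖zcast r‖ := by
    rw [dist_eq_norm, zcast_add, zcast_zsmul]
    refine le_trans (le_of_eq ?_) (norm_sub_le _ _)
    congr 1
    abel
  linarith

/-- for every `G_δ`-subset `Δ` of `P(ℝ^d)` and every countable `D ⊆ Δ` there is a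
free infinite measure preserving `ℤ^d`-action `T` with `D ⊆ 𝓡i(T) ⊆ Δ`. -/
theorem realization_of_rigidity_sets {d : ℕ} (hd : 1 ≤ d)
    (Δ : Set (Projectivization ℝ (Fin d → ℝ))) (hΔ : IsGδ Δ)
    (D : Set (Projectivization ℝ (Fin d → ℝ))) (hDc : D.Countable) (hDΔ : D ⊆ Δ) :
    ∃ (X : Type) (_ : MeasurableSpace X), StandardBorelSpace X ∧
      ∃ μ : Measure X, SigmaFinite μ ∧ μ Set.univ = ⊤ ∧
        ∃ T : (Fin d → ℤ) → X ≃ᵐ X, IsMPAction μ T ∧ IsFreeAction μ T ∧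
          D ⊆ rigSet μ T ∧ rigSet μ T ⊆ Δ := by
  obtain rfl | hDne := D.eq_empty_or_nonempty
  · exact exists_action_without_rigid_directions Δ
  obtain ⟨e, rfl⟩ := hDc.exists_eq_range hDne
  obtain ⟨U, hU, rfl⟩ := hΔ.eq_iInter_nat
  let V : ℕ → Set (Projectivization ℝ (Fin d → ℝ)) := fun k => ⋂ n ∈ Finset.range (k + 1), U n
  have hV : ∀ k, IsOpen (V k) := fun k => isOpen_biInter_finset fun n _ => hU n
  have hθV : ∀ k j, e j ∈ V k := fun k j =>
    mem_iInter₂.2 fun n _ => mem_iInter.1 (hDΔ (mem_range_self j)) n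
  choose g hgθ hgnorm hgfar using fun (k : ℕ) (r : ℝ) =>
    exists_int_near_line (hV k) (hθV k k.unpair.1) (Nat.one_div_pos_of_nat (α := ℝ) (n := k))
      (r + 1 + (k : ℝ) ^ 2 * (r + 2))
  let N : ℕ → ℕ := fun k => 2 ^ k
  let R : ℕ → ℝ := fun k => Nat.rec 0 (fun j r => r + N j * ‖zcast (g j r)‖) k
  let v : ℕ → Fin d → ℤ := fun k => g k (R k)
  have h0 : 0 ≤ R 0 := le_rfl
  have hR : ∀ k, R (k + 1) = R k + N k * ‖zcast (v k)‖ := fun k => rfl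
  have hmono : Monotone R := monotone_nat_of_le_succ fun k => by
    rw [hR]; exact le_add_of_nonneg_right (by positivity)
  have hnonneg : ∀ k, 0 ≤ R k := fun k => hmono (Nat.zero_le k)
  have hgap : ∀ k : ℕ, R k + 1 + (k : ℝ) ^ 2 * (R k + 2) ≤ ‖zcast (v k)‖ := fun k => hgnorm k _
  have hadd : ∀ k : ℕ, 0 ≤ (k : ℝ) ^ 2 * (R k + 2) := fun k =>
    mul_nonneg (sq_nonneg _) (by linarith [hnonneg k])
  obtain ⟨ν, hν, hzero, hone⟩ := exists_riesz_measure (N := N) (v := v) (R := R)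
    (fun k => Nat.one_le_two_pow) h0 hR fun k => by linarith [hgap k, hadd k]
  have hae := ae_tendsto_mFourier_one ν (v := v) fun k => by simpa [N] using hone k
  refine exists_action_of_measure ν (fun γ hγ => ?_) ?_ fun θ hθ γ hγ hγθ hne => ?_
  · refine measure_mFourier_eq_one_eq_zero ν fun m => ?_
    obtain ⟨q, hq⟩ := zsmul_not_mem_spectrumBound h0 hR hgap hγ m
    exact ⟨q, fun i hi him => hzero _ (hq i hi him)⟩
  · rintro _ ⟨i, rfl⟩
    have hpair : Tendsto (fun n => Nat.pair i n) atTop atTop :=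
      tendsto_atTop_mono (fun n => Nat.right_le_pair i n) tendsto_id
    refine ⟨fun n => v (Nat.pair i n), ?_, ?_, hae.mono fun y hy => hy.comp hpair⟩
    · have hnorm : Tendsto (fun k => ‖zcast (v k)‖) atTop atTop := by
        refine tendsto_atTop_mono (fun k => ?_) (tendsto_natCast_atTop_atTop (R := ℝ))
        have hk : (k : ℝ) ≤ 1 + (k : ℝ) ^ 2 * 2 := by nlinarith [sq_nonneg ((k : ℝ) - 1)]
        nlinarith [hgap k, hnonneg k, mul_nonneg (sq_nonneg (k : ℝ)) (hnonneg k)]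
      exact hnorm.comp hpair
    · refine squeeze_zero (fun n => Metric.infDist_nonneg) (fun n => ?_)
        ((tendsto_one_div_add_atTop_nhds_zero_nat (𝕜 := ℝ)).comp hpair)
      simpa using (hgθ (Nat.pair i n) (R (Nat.pair i n))).le
  · rw [mem_iInter, not_forall] at hθ
    obtain ⟨m, hm⟩ := hθ
    obtain ⟨n, ⟨hne, hlarge⟩, hclose⟩ := ((hne.and (hγ.eventually_gt_atTop (R m))).and
      (hγθ.eventually (gt_mem_nhds one_pos))).exists
    obtain ⟨K, hK⟩ : ∃ K, γ n ∈ spectrumBound v N R K := by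
      by_contra! h
      exact hne (hzero _ h)
    obtain h | ⟨k, -, a, ha0, ha, r, hr, heq⟩ := hK
    · rw [h, zcast_zero, norm_zero] at hlarge
      exact hlarge.not_ge (hnonneg m)
    · obtain hkm | hmk := lt_or_ge k m
      · have := (norm_zsmul_add_le hR ha hr).trans (hmono hkm)
        rw [← heq] at this
        exact hlarge.not_ge this
      · have hθk : θ ∉ V k := fun h =>
          hm (mem_iInter₂.1 h m (Finset.mem_range.2 (Nat.lt_succ_of_le hmk)))
        have h1 := hgfar k (R k) θ hθk
        have h2 := le_infDist_zsmul_add θ (v := v k) (r := r) ha0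
        rw [← heq] at h2
        linarith [hadd k]
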